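/- arXiv:1805.11175 — 3 statements merged into one kernel-verified Lean document; each statement's English description precedes it below -/
import Mathlib

section
/- Let S, B : ℝ² × ℝ → ℝ be continuously differentiable with B(x,y,t) < S(x,y,t) for all (x,y,t), let H = S − B, and let u = (u₁,u₂,u₃) : ℝ³ × ℝ → ℝ³ be continuously differentiable. Assume: (i) incompressibility ∂_x u₁ + ∂_y u₂ + ∂_z u₃ = 0 for all (x,y,z,t) with B(x,y,t) ≤ z ≤ S(x,y,t); (ii) the upper free-surface equation ∂_t S − u₃|_{z=S} + u₁|_{z=S} ∂_x S + u₂|_{z=S} ∂_y S = + ‖k̂ − ∇S‖ smb; (iii) the lower free-surface equation ∂_t B − u₃|_{z=B} + u₁|_{z=B} ∂_x B + u₂|_{z=B} ∂_y B = − ‖∇B − k̂‖ bmb, where smb, bmb : ℝ² × ℝ → ℝ. Then the vertically-integrated mass-balance relation holds: ∂_t H + ∂_x(H ū₁) + ∂_y(H ū₂) = ‖k̂ − ∇S‖ smb + ‖∇B − k̂‖ bmb, where H ū_i (x,y,t) = ∫_{B(x,y,t)}^{S(x,y,t)} u_i(x,y,z,t) dz for i = 1, 2. -/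
open Filter Topology MeasureTheory in
lemma edge_aux (f : ℝ → ℝ → ℝ) (hf : Continuous (fun p : ℝ × ℝ => f p.1 p.2))
    (g : ℝ → ℝ) (hg : Continuous g) (g' x0 : ℝ) (hd : HasDerivAt g g' x0) :
    HasDerivAt (fun x => ∫ z in g x0..g x, f x z) (g' * f x0 (g x0)) x0 := by
  have hK : Continuous (fun x => ∫ s in (0:ℝ)..1, f x (g x0 + (g x - g x0) * s)) := by
    apply intervalIntegral.continuous_parametric_intervalIntegral_of_continuous'
    exact hf.comp (f := fun p : ℝ × ℝ => (p.1, g x0 + (g p.1 - g x0) * p.2)) (by fun_prop)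
  have hG : ∀ x, ∫ z in g x0..g x, f x z
      = (g x - g x0) * ∫ s in (0:ℝ)..1, f x (g x0 + (g x - g x0) * s) := by
    intro x
    have := intervalIntegral.smul_integral_comp_add_mul (a := 0) (b := 1) (f x) (g x - g x0) (g x0)
    simp only [smul_eq_mul] at this
    rw [this]
    congr 1 <;> ring
  rw [hasDerivAt_iff_tendsto_slope] at hd ⊢
  have h2 := hd.mul (hK.continuousAt (x := x0)).continuousWithinAt.tendsto
  have h3 : (∫ s in (0:ℝ)..1, f x0 (g x0 + (g x0 - g x0) * s)) = f x0 (g x0) := by simp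
  rw [h3] at h2
  refine h2.congr ?_
  intro x
  simp only [slope_def_field]
  rw [hG x, intervalIntegral.integral_same, sub_zero]
  ring

lemma partial_aux (f : ℝ → ℝ → ℝ) (hf : ContDiff ℝ 1 (fun p : ℝ × ℝ => f p.1 p.2)) :
    (∀ x z, HasDerivAt (fun x' => f x' z) (deriv (fun x' => f x' z) x) x) ∧
    Continuous (fun p : ℝ × ℝ => deriv (fun x' => f x' p.2) p.1) := by
  have h : ∀ x z, HasDerivAt (fun x' => f x' z)
      (fderiv ℝ (fun p : ℝ × ℝ => f p.1 p.2) (x, z) (1, 0)) x := by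
    intro x z
    have h1 := ((hf.differentiable one_ne_zero) (x, z)).hasFDerivAt
    exact h1.comp_hasDerivAt (f := fun x' => (x', z)) x
      ((hasDerivAt_id x).prodMk (hasDerivAt_const x z))
  refine ⟨fun x z => (h x z).differentiableAt.hasDerivAt, ?_⟩
  have : (fun p : ℝ × ℝ => deriv (fun x' => f x' p.2) p.1)
      = fun p => fderiv ℝ (fun p : ℝ × ℝ => f p.1 p.2) p (1, 0) := by
    funext p
    exact (h p.1 p.2).deriv
  rw [this]
  exact (hf.continuous_fderiv one_ne_zero).clm_apply continuous_const

open Filter Topology MeasureTheory in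
lemma leibniz_aux (f : ℝ → ℝ → ℝ) (hf : ContDiff ℝ 1 (fun p : ℝ × ℝ => f p.1 p.2))
    (a b : ℝ → ℝ) (ha : Differentiable ℝ a) (hb : Differentiable ℝ b) (x0 : ℝ) :
    HasDerivAt (fun x => ∫ z in a x..b x, f x z)
      ((∫ z in a x0..b x0, deriv (fun x' => f x' z) x0)
        + deriv b x0 * f x0 (b x0) - deriv a x0 * f x0 (a x0)) x0 := by
  obtain ⟨hd, hc⟩ := partial_aux f hf
  have hfc := hf.continuous
  have hfx : ∀ x, Continuous (f x) := fun x =>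
    hfc.comp (f := fun z => (x, z)) (by fun_prop)
  have hcx : ∀ x, Continuous (fun z => deriv (fun x' => f x' z) x) := fun x =>
    hc.comp (f := fun z => (x, z)) (by fun_prop)
  obtain ⟨C, hC⟩ := ((isCompact_Icc (a := x0 - 1) (b := x0 + 1)).prod
    (isCompact_uIcc (a := a x0) (b := b x0))).exists_bound_of_continuousOn hc.continuousOn
  have h1 : HasDerivAt (fun x => ∫ z in a x0..b x0, f x z)
      (∫ z in a x0..b x0, deriv (fun x' => f x' z) x0) x0 := by
    refine (intervalIntegral.hasDerivAt_integral_of_dominated_loc_of_deriv_le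
      (F' := fun x z => deriv (fun x' => f x' z) x) (bound := fun _ => C)
      (Icc_mem_nhds (show x0 - 1 < x0 by linarith) (show x0 < x0 + 1 by linarith))
      (Eventually.of_forall fun x => (hfx x).aestronglyMeasurable)
      ((hfx x0).intervalIntegrable _ _) (hcx x0).aestronglyMeasurable
      (Eventually.of_forall fun z hz x hx => hC (x, z) ⟨hx, Set.uIoc_subset_uIcc hz⟩)
      (by simp) (Eventually.of_forall fun z _ x _ => hd x z)).2
  have h2 := edge_aux f hfc b hb.continuous _ x0 (hb x0).hasDerivAt
  have h3 := edge_aux f hfc a ha.continuous _ x0 (ha x0).hasDerivAt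
  refine ((h1.add h2).sub h3).congr_of_eventuallyEq (Eventually.of_forall fun x => ?_)
  have i : ∀ p q, IntervalIntegrable (f x) volume p q := fun p q =>
    (hfx x).intervalIntegrable p q
  have e1 := intervalIntegral.integral_add_adjacent_intervals (i (a x0) (b x0)) (i (b x0) (b x))
  have e2 := intervalIntegral.integral_add_adjacent_intervals (i (a x0) (a x)) (i (a x) (b x))
  simp only [Pi.add_apply, Pi.sub_apply]
  linarith

/-- Vertically-integrated mass balance: if an incompressible velocity field satisfies the
upper and lower free-surface equations, then the thickness `H = S - B` satisfies
`∂ₜH + ∂ₓ(Hū₁) + ∂_y(Hū₂) = ‖k̂ - ∇S‖ smb + ‖∇B - k̂‖ bmb`, where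
`Hūᵢ = ∫_B^S uᵢ dz`. -/
theorem vertically_integrated_mass_balance
    (S B : ℝ → ℝ → ℝ → ℝ)
    (u1 u2 u3 : ℝ → ℝ → ℝ → ℝ → ℝ)
    (smb bmb : ℝ → ℝ → ℝ → ℝ)
    (hS : ContDiff ℝ 1 (fun p : ℝ × ℝ × ℝ => S p.1 p.2.1 p.2.2))
    (hB : ContDiff ℝ 1 (fun p : ℝ × ℝ × ℝ => B p.1 p.2.1 p.2.2))
    (hBS : ∀ x y t, B x y t < S x y t)
    (hu1 : ContDiff ℝ 1 (fun p : ℝ × ℝ × ℝ × ℝ => u1 p.1 p.2.1 p.2.2.1 p.2.2.2))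
    (hu2 : ContDiff ℝ 1 (fun p : ℝ × ℝ × ℝ × ℝ => u2 p.1 p.2.1 p.2.2.1 p.2.2.2))
    (hu3 : ContDiff ℝ 1 (fun p : ℝ × ℝ × ℝ × ℝ => u3 p.1 p.2.1 p.2.2.1 p.2.2.2))
    (hincomp : ∀ x y z t, B x y t ≤ z → z ≤ S x y t →
      deriv (fun x' => u1 x' y z t) x + deriv (fun y' => u2 x y' z t) y +
        deriv (fun z' => u3 x y z' t) z = 0)
    (hupper : ∀ x y t,
      deriv (fun t' => S x y t') t - u3 x y (S x y t) t
        + u1 x y (S x y t) t * deriv (fun x' => S x' y t) x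
        + u2 x y (S x y t) t * deriv (fun y' => S x y' t) y
      = Real.sqrt (1 + (deriv (fun x' => S x' y t) x) ^ 2 +
          (deriv (fun y' => S x y' t) y) ^ 2) * smb x y t)
    (hlower : ∀ x y t,
      deriv (fun t' => B x y t') t - u3 x y (B x y t) t
        + u1 x y (B x y t) t * deriv (fun x' => B x' y t) x
        + u2 x y (B x y t) t * deriv (fun y' => B x y' t) y
      = -(Real.sqrt (1 + (deriv (fun x' => B x' y t) x) ^ 2 +
          (deriv (fun y' => B x y' t) y) ^ 2) * bmb x y t)) :
    ∀ x y t,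
      deriv (fun t' => S x y t' - B x y t') t
        + deriv (fun x' => ∫ z in B x' y t..S x' y t, u1 x' y z t) x
        + deriv (fun y' => ∫ z in B x y' t..S x y' t, u2 x y' z t) y
      = Real.sqrt (1 + (deriv (fun x' => S x' y t) x) ^ 2 +
            (deriv (fun y' => S x y' t) y) ^ 2) * smb x y t
        + Real.sqrt (1 + (deriv (fun x' => B x' y t) x) ^ 2 +
            (deriv (fun y' => B x y' t) y) ^ 2) * bmb x y t := by
  intro x y t
  have hSx : Differentiable ℝ (fun x' => S x' y t) :=
    (hS.differentiable one_ne_zero).comp (f := fun x' => (x', y, t)) (by fun_prop)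
  have hBx : Differentiable ℝ (fun x' => B x' y t) :=
    (hB.differentiable one_ne_zero).comp (f := fun x' => (x', y, t)) (by fun_prop)
  have hSy : Differentiable ℝ (fun y' => S x y' t) :=
    (hS.differentiable one_ne_zero).comp (f := fun y' => (x, y', t)) (by fun_prop)
  have hBy : Differentiable ℝ (fun y' => B x y' t) :=
    (hB.differentiable one_ne_zero).comp (f := fun y' => (x, y', t)) (by fun_prop)
  have hSt : Differentiable ℝ (fun t' => S x y t') :=
    (hS.differentiable one_ne_zero).comp (f := fun t' => (x, y, t')) (by fun_prop)
  have hBt : Differentiable ℝ (fun t' => B x y t') :=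
    (hB.differentiable one_ne_zero).comp (f := fun t' => (x, y, t')) (by fun_prop)
  have c1 : ContDiff ℝ 1 (fun p : ℝ × ℝ => (fun x' z => u1 x' y z t) p.1 p.2) :=
    hu1.comp (f := fun p : ℝ × ℝ => (p.1, y, p.2, t)) (by fun_prop)
  have c2 : ContDiff ℝ 1 (fun p : ℝ × ℝ => (fun y' z => u2 x y' z t) p.1 p.2) :=
    hu2.comp (f := fun p : ℝ × ℝ => (x, p.1, p.2, t)) (by fun_prop)
  have c3 : ContDiff ℝ 1 (fun p : ℝ × ℝ => (fun z (_ : ℝ) => u3 x y z t) p.1 p.2) :=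
    hu3.comp (f := fun p : ℝ × ℝ => (x, y, p.1, t)) (by fun_prop)
  have L1 := (leibniz_aux (fun x' z => u1 x' y z t) c1 (fun x' => B x' y t) (fun x' => S x' y t) hBx hSx x).deriv
  have L2 := (leibniz_aux (fun y' z => u2 x y' z t) c2 (fun y' => B x y' t) (fun y' => S x y' t) hBy hSy y).deriv
  have k1 : Continuous (fun z => deriv (fun x' => u1 x' y z t) x) :=
    (partial_aux (fun x' z => u1 x' y z t) c1).2.comp (f := fun z => (x, z)) (by fun_prop)
  have k2 : Continuous (fun z => deriv (fun y' => u2 x y' z t) y) :=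
    (partial_aux (fun y' z => u2 x y' z t) c2).2.comp (f := fun z => (y, z)) (by fun_prop)
  have k3 : Continuous (fun z => deriv (fun z' => u3 x y z' t) z) :=
    (partial_aux (fun z (_ : ℝ) => u3 x y z t) c3).2.comp (f := fun z => (z, 0)) (by fun_prop)
  have k12 : Continuous (fun z => deriv (fun x' => u1 x' y z t) x
      + deriv (fun y' => u2 x y' z t) y) := k1.add k2
  have F3 : ∫ z in B x y t..S x y t, deriv (fun z' => u3 x y z' t) z
      = u3 x y (S x y t) t - u3 x y (B x y t) t :=
    intervalIntegral.integral_eq_sub_of_hasDerivAt (f := fun z => u3 x y z t)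
      (fun z _ => (partial_aux (fun z (_ : ℝ) => u3 x y z t) c3).1 z 0) (k3.intervalIntegrable _ _)
  have Z : (∫ z in B x y t..S x y t, deriv (fun x' => u1 x' y z t) x)
      + (∫ z in B x y t..S x y t, deriv (fun y' => u2 x y' z t) y)
      + (∫ z in B x y t..S x y t, deriv (fun z' => u3 x y z' t) z) = 0 := by
    rw [← intervalIntegral.integral_add (k1.intervalIntegrable _ _) (k2.intervalIntegrable _ _),
      ← intervalIntegral.integral_add (k12.intervalIntegrable _ _)
        (k3.intervalIntegrable _ _)]
    rw [intervalIntegral.integral_congr (g := fun _ => (0 : ℝ))]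
    · simp
    · intro z hz
      rw [Set.uIcc_of_le (hBS x y t).le] at hz
      exact hincomp x y z t hz.1 hz.2
  have T : deriv (fun t' => S x y t' - B x y t') t
      = deriv (fun t' => S x y t') t - deriv (fun t' => B x y t') t :=
    deriv_fun_sub (hSt t) (hBt t)
  have U := hupper x y t
  have W := hlower x y t
  rw [T, L1, L2]
  linarith
end

section
/- Let S, B : ℝ → ℝ be continuously differentiable with H(y) = S(y) − B(y) > 0 for all y, and set G(y) = H'(y)/H(y), ξ(y,z) = (z − B(y))/H(y), and C(y,z) = ξ(y,z) S'(y) + (1 − ξ(y,z)) B'(y). Suppose the source term has the separated form A(y,z) = Ã(y, ξ(y,z)), where Ã : ℝ × ℝ → ℝ is continuous and continuously differentiable in its second argument. Fix y₀ ∈ ℝ and define u : ℝ × ℝ → ℝ by u(y,z) = −(1/H(y)) ∫_{y₀}^{y} H(s) Ã(s, ξ(y,z)) ds. Then u is differentiable and solves the linear first-order partial differential equation A(y,z) + G(y) u(y,z) + ∂_y u(y,z) + C(y,z) ∂_z u(y,z) = 0 for all (y,z) ∈ ℝ². -/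
theorem aux_param (f f' : ℝ → ℝ → ℝ) (hf : Continuous (fun p : ℝ × ℝ => f p.1 p.2))
    (hf' : Continuous (fun p : ℝ × ℝ => f' p.1 p.2))
    (hd : ∀ s r, HasDerivAt (fun r => f s r) (f' s r) r) (a b r : ℝ) :
    HasDerivAt (fun r => ∫ s in a..b, f s r) (∫ s in a..b, f' s r) r := by
  have hK : IsCompact (Set.uIcc a b ×ˢ Metric.closedBall r 1) :=
    isCompact_uIcc.prod (isCompact_closedBall r 1)
  obtain ⟨M, hM⟩ := hK.exists_bound_of_continuousOn hf'.continuousOn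
  refine (intervalIntegral.hasDerivAt_integral_of_dominated_loc_of_deriv_le
    (F := fun r s => f s r) (F' := fun r s => f' s r) (bound := fun _ => M)
    (Metric.closedBall_mem_nhds r one_pos) ?_ ?_ ?_ ?_ ?_ ?_).2
  · refine Filter.Eventually.of_forall fun x => ?_
    exact (hf.comp (by fun_prop : Continuous fun s : ℝ => (s, x))).aestronglyMeasurable
  · exact (hf.comp (by fun_prop : Continuous fun s : ℝ => (s, r))).intervalIntegrable _ _
  · exact (hf'.comp (by fun_prop : Continuous fun s : ℝ => (s, r))).aestronglyMeasurable
  · refine Filter.Eventually.of_forall fun t ht x hx => ?_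
    exact hM (t, x) ⟨Set.uIoc_subset_uIcc ht, hx⟩
  · exact intervalIntegrable_const
  · exact Filter.Eventually.of_forall fun t ht x hx => hd t x

theorem aux_joint (f f' : ℝ → ℝ → ℝ) (hf : Continuous (fun p : ℝ × ℝ => f p.1 p.2))
    (hf' : Continuous (fun p : ℝ × ℝ => f' p.1 p.2))
    (hd : ∀ s r, HasDerivAt (fun r => f s r) (f' s r) r) (a : ℝ) (p : ℝ × ℝ) :
    HasFDerivAt (fun p : ℝ × ℝ => ∫ s in a..p.1, f s p.2)
      ((ContinuousLinearMap.toSpanSingleton ℝ (f p.1 p.2)).coprod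
        (ContinuousLinearMap.toSpanSingleton ℝ (∫ s in a..p.1, f' s p.2))) p := by
  refine (hasStrictFDerivAt_uncurry_coprod (𝕜 := ℝ) (u := p)
    (f := fun y r => ∫ s in a..y, f s r)
    (f₁ := fun y r => ContinuousLinearMap.toSpanSingleton ℝ (f y r))
    (f₂ := fun y r => ContinuousLinearMap.toSpanSingleton ℝ (∫ s in a..y, f' s r))
    ?_ ?_ ?_ ?_).hasFDerivAt
  · refine Filter.Eventually.of_forall fun v => ?_
    have hc : Continuous fun s => f s v.2 := hf.comp (by fun_prop : Continuous fun s : ℝ => (s, v.2))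
    exact (intervalIntegral.integral_hasDerivAt_right (hc.intervalIntegrable _ _)
      hc.stronglyMeasurable.stronglyMeasurableAtFilter hc.continuousAt).hasFDerivAt
  · refine Filter.Eventually.of_forall fun v => ?_
    exact (aux_param f f' hf hf' hd a v.1 v.2).hasFDerivAt
  · exact ((ContinuousLinearMap.toSpanSingletonCLE (𝕜 := ℝ) (E := ℝ)).continuous.comp hf).continuousAt
  · have : Continuous fun p : ℝ × ℝ => ∫ s in a..p.1, f' s p.2 :=
      intervalIntegral.continuous_parametric_intervalIntegral_of_continuous
        (f := fun (p : ℝ × ℝ) s => f' s p.2)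
        (hf'.comp (by fun_prop : Continuous fun q : (ℝ × ℝ) × ℝ => (q.2, q.1.2))) continuous_fst
    exact ((ContinuousLinearMap.toSpanSingletonCLE (𝕜 := ℝ) (E := ℝ)).continuous.comp this).continuousAt

/-- Invariant-manifold solution by the method of characteristics: with `H = S - B > 0`,
`G = H'/H`, `ξ(y,z) = (z - B)/H`, `C = ξ S' + (1 - ξ) B'`, and a separated source
`A(y,z) = Ã(y, ξ(y,z))` (with `Ã` continuous and C¹ in its second argument), the function
`u(y,z) = -(1/H(y)) ∫_{y₀}^{y} H(s) Ã(s, ξ(y,z)) ds` is differentiable and solves the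
linear first-order PDE `A + G u + ∂_y u + C ∂_z u = 0`. -/
theorem characteristics_solution
    (S B : ℝ → ℝ) (hS : ContDiff ℝ 1 S) (hB : ContDiff ℝ 1 B)
    (hH : ∀ y, 0 < S y - B y)
    (Atil Atil' : ℝ × ℝ → ℝ)
    (hAc : Continuous Atil)
    (hA' : ∀ p : ℝ × ℝ, HasDerivAt (fun r => Atil (p.1, r)) (Atil' p) p.2)
    (hA'c : Continuous Atil')
    (y₀ : ℝ)
    (u : ℝ → ℝ → ℝ)
    (hu : ∀ y z, u y z =
      -(1 / (S y - B y)) * ∫ s in y₀..y, (S s - B s) * Atil (s, (z - B y) / (S y - B y))) :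
    Differentiable ℝ (fun p : ℝ × ℝ => u p.1 p.2) ∧
    ∀ y z : ℝ,
      Atil (y, (z - B y) / (S y - B y))
        + (deriv (fun y' => S y' - B y') y / (S y - B y)) * u y z
        + deriv (fun y' => u y' z) y
        + (((z - B y) / (S y - B y)) * deriv S y
            + (1 - (z - B y) / (S y - B y)) * deriv B y) * deriv (fun z' => u y z') z = 0 := by
  have hSd : Differentiable ℝ S := hS.differentiable (by norm_num)
  have hBd : Differentiable ℝ B := hB.differentiable (by norm_num)
  have hSc : Continuous S := hS.continuous
  have hBc : Continuous B := hB.continuous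
  have hJ := aux_joint (fun s r => (S s - B s) * Atil (s, r)) (fun s r => (S s - B s) * Atil' (s, r))
    (by fun_prop) (by fun_prop) (fun s r => (hA' (s, r)).const_mul _) y₀
  have hne : ∀ y, S y - B y ≠ 0 := fun y => (hH y).ne'
  constructor
  · have h1 : Differentiable ℝ (fun p : ℝ × ℝ => (p.1, (p.2 - B p.1) / (S p.1 - B p.1))) := by
      have := fun p : ℝ × ℝ => hne p.1
      fun_prop (disch := assumption)
    have h2 : Differentiable ℝ (fun p : ℝ × ℝ => -(1 / (S p.1 - B p.1))) := by
      have h0 : Differentiable ℝ (fun p : ℝ × ℝ => S p.1 - B p.1) := by fun_prop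
      simpa only [one_div] using (h0.fun_inv (fun p : ℝ × ℝ => hne p.1)).fun_neg
    have hJd : Differentiable ℝ (fun p : ℝ × ℝ => ∫ s in y₀..p.1, (S s - B s) * Atil (s, p.2)) :=
      fun p => (hJ p).differentiableAt
    have := h2.mul (hJd.comp h1)
    have e : (fun p : ℝ × ℝ => u p.1 p.2) = _ := funext fun p => hu p.1 p.2
    rw [e]
    exact this
  · intro y z
    have hSy := (hSd y).hasDerivAt
    have hBy := (hBd y).hasDerivAt
    have hHy := hSy.fun_sub hBy
    have hxy := ((hBy.const_sub z).fun_div hHy (hne y))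
    have hxz := (((hasDerivAt_id z).sub_const (B y)).div_const (S y - B y))
    have c1 := HasFDerivAt.comp_hasDerivAt (f := fun y' => (y', (z - B y') / (S y' - B y'))) y
      (hJ (y, (z - B y) / (S y - B y))) ((hasDerivAt_id y).prodMk hxy)
    have c2 := HasFDerivAt.comp_hasDerivAt (f := fun z' => (y, (z' - B y) / (S y - B y))) z
      (hJ (y, (z - B y) / (S y - B y))) ((hasDerivAt_const z y).prodMk hxz)
    have d1 := (((hasDerivAt_const y (1 : ℝ)).fun_div hHy (hne y)).fun_neg).fun_mul c1
    have d2 := c2.const_mul (-(1 / (S y - B y)))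
    have e1 : (fun y' => u y' z) = fun y' => -(1 / (S y' - B y')) *
        ∫ s in y₀..y', (S s - B s) * Atil (s, (z - B y') / (S y' - B y')) := by
      funext y'; exact hu _ _
    have e2 : (fun z' => u y z') = fun z' => -(1 / (S y - B y)) *
        ∫ s in y₀..y, (S s - B s) * Atil (s, (z' - B y) / (S y - B y)) := by
      funext y'; exact hu _ _
    have d1' := d1.deriv
    have d2' := d2.deriv
    simp only [Function.comp_def] at d1' d2'
    rw [e1, e2, d1', d2', hHy.deriv, hu y z]
    simp only [ContinuousLinearMap.coprod_apply, ContinuousLinearMap.toSpanSingleton_apply, smul_eq_mul]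
    generalize (∫ s in y₀..y, (S s - B s) * Atil (s, (z - B y) / (S y - B y))) = I
    generalize (∫ s in y₀..y, (S s - B s) * Atil' (s, (z - B y) / (S y - B y))) = I'
    generalize Atil (y, (z - B y) / (S y - B y)) = A
    have := hne y
    field_simp
    ring
end

section
/- Let S, B, u_{xS}, u_{xB}, f_S, f_B : ℝ² × ℝ → ℝ (functions of (x,y,t)) with S, B, u_{xS}, u_{xB} having the first partial derivatives appearing below, let H = S − B > 0, let λ ∈ ℝ, and let u_y : ℝ³ × ℝ → ℝ be continuously differentiable. On the open region B(x,y,t) < z < S(x,y,t), define the relative coordinates ξ_B = (S − z)/H and ξ_S = (z − B)/H, the horizontal velocity u_x(x,y,z,t) = (u_{xS} − u_{xB})(1 − ξ_B^λ) + u_{xB}, the surface vertical velocities u_{zS} = −‖k̂ − ∇S‖ f_S + ∂_t S + u_x ∂_x S + u_y ∂_y S and u_{zB} = +‖∇B − k̂‖ f_B + ∂_t B + u_x ∂_x B + u_y ∂_y B (with u_x, u_y evaluated at (x,y,z,t)), and the interpolated vertical velocity u_z = ξ_S u_{zS} + ξ_B u_{zB}. Then the divergence of the velocity field satisfies the identity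 ∂_x u_x + ∂_y u_y + ∂_z u_z = A + G u_y + ∂_y u_y + C ∂_z u_y, where A = ∂_x u_{xS} + (1/H)(∂_t H + u_{xS} ∂_x H − ‖k̂ − ∇S‖ f_S − ‖∇B − k̂‖ f_B) + ξ_B^λ (∂_x u_{xB} − ∂_x u_{xS} + (u_{xS} − u_{xB}) ∂_x B / H) − ξ_B^λ (u_{xS} − u_{xB}) ∂_x S / H, G = (1/H) ∂_y H, and C = ξ_S ∂_y S + ξ_B ∂_y B. In particular, the velocity (u_x, u_y, u_z) is divergence free at a point of the region if and only if u_y satisfies A + G u_y + ∂_y u_y + C ∂_z u_y = 0 there. -/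
noncomputable section

/-- Partial derivative in the first (x) argument of a function of `(x, y, t)`. -/
def pdx (f : ℝ → ℝ → ℝ → ℝ) (x y t : ℝ) : ℝ := deriv (fun x' => f x' y t) x

/-- Partial derivative in the second (y) argument of a function of `(x, y, t)`. -/
def pdy (f : ℝ → ℝ → ℝ → ℝ) (x y t : ℝ) : ℝ := deriv (fun y' => f x y' t) y

/-- Partial derivative in the third (t) argument of a function of `(x, y, t)`. -/
def pdt (f : ℝ → ℝ → ℝ → ℝ) (x y t : ℝ) : ℝ := deriv (fun t' => f x y t') t

/-- Magnitude of the spatial gradient of an implicit surface: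
`‖k̂ - ∇S‖ = ‖∇S - k̂‖ = √(1 + (∂ₓS)² + (∂_yS)²)`. -/
def normGrad (f : ℝ → ℝ → ℝ → ℝ) (x y t : ℝ) : ℝ :=
  Real.sqrt (1 + (pdx f x y t) ^ 2 + (pdy f x y t) ^ 2)

/-- Relative coordinate `ξ_B = (S - z)/H`. -/
def xiB (S B : ℝ → ℝ → ℝ → ℝ) (x y z t : ℝ) : ℝ :=
  (S x y t - z) / (S x y t - B x y t)

/-- Relative coordinate `ξ_S = (z - B)/H`. -/
def xiS (S B : ℝ → ℝ → ℝ → ℝ) (x y z t : ℝ) : ℝ :=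
  (z - B x y t) / (S x y t - B x y t)

/-- Horizontal velocity `u_x = (u_{xS} - u_{xB})(1 - ξ_B^λ) + u_{xB}`. -/
def ux (S B uxS uxB : ℝ → ℝ → ℝ → ℝ) (lam : ℝ) (x y z t : ℝ) : ℝ :=
  (uxS x y t - uxB x y t) * (1 - xiB S B x y z t ^ lam) + uxB x y t

/-- Vertical velocity at the upper surface:
`u_{zS} = -‖k̂ - ∇S‖ f_S + ∂ₜS + u_x ∂ₓS + u_y ∂_yS`. -/
def uzS (S B uxS uxB fS : ℝ → ℝ → ℝ → ℝ) (lam : ℝ) (uy : ℝ → ℝ → ℝ → ℝ → ℝ)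
    (x y z t : ℝ) : ℝ :=
  -(normGrad S x y t) * fS x y t + pdt S x y t
    + ux S B uxS uxB lam x y z t * pdx S x y t + uy x y z t * pdy S x y t

/-- Vertical velocity at the lower surface:
`u_{zB} = +‖∇B - k̂‖ f_B + ∂ₜB + u_x ∂ₓB + u_y ∂_yB`. -/
def uzB (S B uxS uxB fB : ℝ → ℝ → ℝ → ℝ) (lam : ℝ) (uy : ℝ → ℝ → ℝ → ℝ → ℝ)
    (x y z t : ℝ) : ℝ :=
  normGrad B x y t * fB x y t + pdt B x y t
    + ux S B uxS uxB lam x y z t * pdx B x y t + uy x y z t * pdy B x y t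

/-- Linearly interpolated vertical velocity `u_z = ξ_S u_{zS} + ξ_B u_{zB}`. -/
def uz (S B uxS uxB fS fB : ℝ → ℝ → ℝ → ℝ) (lam : ℝ) (uy : ℝ → ℝ → ℝ → ℝ → ℝ)
    (x y z t : ℝ) : ℝ :=
  xiS S B x y z t * uzS S B uxS uxB fS lam uy x y z t
    + xiB S B x y z t * uzB S B uxS uxB fB lam uy x y z t

/-- Coefficient `A` of the linear first-order PDE for `u_y`. -/
def coefA (S B uxS uxB fS fB : ℝ → ℝ → ℝ → ℝ) (lam : ℝ) (x y z t : ℝ) : ℝ :=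
  pdx uxS x y t
    + (1 / (S x y t - B x y t)) *
        (pdt (fun x' y' t' => S x' y' t' - B x' y' t') x y t
          + uxS x y t * pdx (fun x' y' t' => S x' y' t' - B x' y' t') x y t
          - normGrad S x y t * fS x y t - normGrad B x y t * fB x y t)
    + xiB S B x y z t ^ lam *
        (pdx uxB x y t - pdx uxS x y t
          + (uxS x y t - uxB x y t) * pdx B x y t / (S x y t - B x y t))
    - xiB S B x y z t ^ lam *
        (uxS x y t - uxB x y t) * pdx S x y t / (S x y t - B x y t)

/-- Coefficient `G = (1/H) ∂_y H` of the linear first-order PDE for `u_y`. -/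
def coefG (S B : ℝ → ℝ → ℝ → ℝ) (x y t : ℝ) : ℝ :=
  (1 / (S x y t - B x y t)) * pdy (fun x' y' t' => S x' y' t' - B x' y' t') x y t

/-- Coefficient `C = ξ_S ∂_yS + ξ_B ∂_yB` of the linear first-order PDE for `u_y`. -/
def coefC (S B : ℝ → ℝ → ℝ → ℝ) (x y z t : ℝ) : ℝ :=
  xiS S B x y z t * pdy S x y t + xiB S B x y z t * pdy B x y t

/-- Divergence identity for the analytic ice-sheet velocity: on the region `B < z < S`,
`∂ₓu_x + ∂_yu_y + ∂_zu_z = A + G u_y + ∂_yu_y + C ∂_zu_y`; in particular the velocity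
`(u_x, u_y, u_z)` is divergence free at a point of the region if and only if `u_y`
satisfies the linear first-order PDE `A + G u_y + ∂_yu_y + C ∂_zu_y = 0` there. -/
theorem analytic_velocity_divergence_identity
    (S B uxS uxB fS fB : ℝ → ℝ → ℝ → ℝ) (lam : ℝ)
    (uy : ℝ → ℝ → ℝ → ℝ → ℝ)
    (hS : Differentiable ℝ (fun p : ℝ × ℝ × ℝ => S p.1 p.2.1 p.2.2))
    (hB : Differentiable ℝ (fun p : ℝ × ℝ × ℝ => B p.1 p.2.1 p.2.2))
    (huxS : Differentiable ℝ (fun p : ℝ × ℝ × ℝ => uxS p.1 p.2.1 p.2.2))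
    (huxB : Differentiable ℝ (fun p : ℝ × ℝ × ℝ => uxB p.1 p.2.1 p.2.2))
    (hH : ∀ x y t, 0 < S x y t - B x y t)
    (huy : ContDiff ℝ 1 (fun p : ℝ × ℝ × ℝ × ℝ => uy p.1 p.2.1 p.2.2.1 p.2.2.2)) :
    ∀ x y z t : ℝ, B x y t < z → z < S x y t →
      (deriv (fun x' => ux S B uxS uxB lam x' y z t) x
          + deriv (fun y' => uy x y' z t) y
          + deriv (fun z' => uz S B uxS uxB fS fB lam uy x y z' t) z
        = coefA S B uxS uxB fS fB lam x y z t
          + coefG S B x y t * uy x y z t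
          + deriv (fun y' => uy x y' z t) y
          + coefC S B x y z t * deriv (fun z' => uy x y z' t) z)
      ∧
      ((deriv (fun x' => ux S B uxS uxB lam x' y z t) x
          + deriv (fun y' => uy x y' z t) y
          + deriv (fun z' => uz S B uxS uxB fS fB lam uy x y z' t) z = 0)
        ↔
        (coefA S B uxS uxB fS fB lam x y z t
          + coefG S B x y t * uy x y z t
          + deriv (fun y' => uy x y' z t) y
          + coefC S B x y z t * deriv (fun z' => uy x y z' t) z = 0)) := by
  intro x y z t hz1 hz2
  refine and_iff_left_of_imp (fun h => by rw [h]) |>.mpr ?_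
  have hHp := hH x y t
  have hH0 : S x y t - B x y t ≠ 0 := hHp.ne'
  have dx : ∀ f : ℝ → ℝ → ℝ → ℝ, Differentiable ℝ (fun p : ℝ × ℝ × ℝ => f p.1 p.2.1 p.2.2) →
      HasDerivAt (fun x' => f x' y t) (pdx f x y t) x := by
    intro f hf
    have : Differentiable ℝ (fun x' : ℝ => f x' y t) :=
      hf.comp (g := fun p : ℝ × ℝ × ℝ => f p.1 p.2.1 p.2.2)
        (f := fun x' : ℝ => (x', y, t)) (by fun_prop)
    exact (this x).hasDerivAt
  have dy : ∀ f : ℝ → ℝ → ℝ → ℝ, Differentiable ℝ (fun p : ℝ × ℝ × ℝ => f p.1 p.2.1 p.2.2) →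
      HasDerivAt (fun y' => f x y' t) (pdy f x y t) y := by
    intro f hf
    have : Differentiable ℝ (fun y' : ℝ => f x y' t) :=
      hf.comp (g := fun p : ℝ × ℝ × ℝ => f p.1 p.2.1 p.2.2)
        (f := fun y' : ℝ => (x, y', t)) (by fun_prop)
    exact (this y).hasDerivAt
  have dt : ∀ f : ℝ → ℝ → ℝ → ℝ, Differentiable ℝ (fun p : ℝ × ℝ × ℝ => f p.1 p.2.1 p.2.2) →
      HasDerivAt (fun t' => f x y t') (pdt f x y t) t := by
    intro f hf
    have : Differentiable ℝ (fun t' : ℝ => f x y t') :=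
      hf.comp (g := fun p : ℝ × ℝ × ℝ => f p.1 p.2.1 p.2.2)
        (f := fun t' : ℝ => (x, y, t')) (by fun_prop)
    exact (this t).hasDerivAt
  have duy : HasDerivAt (fun z' => uy x y z' t) (deriv (fun z' => uy x y z' t) z) z := by
    have : Differentiable ℝ (fun z' : ℝ => uy x y z' t) :=
      (huy.differentiable one_ne_zero).comp
        (g := fun p : ℝ × ℝ × ℝ × ℝ => uy p.1 p.2.1 p.2.2.1 p.2.2.2)
        (f := fun z' : ℝ => (x, y, z', t)) (by fun_prop)
    exact (this z).hasDerivAt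
  have eHx : pdx (fun x' y' t' => S x' y' t' - B x' y' t') x y t = pdx S x y t - pdx B x y t :=
    ((dx S hS).sub (dx B hB)).deriv
  have eHy : pdy (fun x' y' t' => S x' y' t' - B x' y' t') x y t = pdy S x y t - pdy B x y t :=
    ((dy S hS).sub (dy B hB)).deriv
  have eHt : pdt (fun x' y' t' => S x' y' t' - B x' y' t') x y t = pdt S x y t - pdt B x y t :=
    ((dt S hS).sub (dt B hB)).deriv
  have hxi : 0 < xiB S B x y z t := div_pos (by linarith) hHp
  have dxix : HasDerivAt (fun x' => xiB S B x' y z t) _ x :=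
    ((dx S hS).sub_const z).div ((dx S hS).sub (dx B hB)) hH0
  have dxiz : HasDerivAt (fun z' => xiB S B x y z' t) (-1 / (S x y t - B x y t)) z :=
    ((hasDerivAt_id z).const_sub (S x y t)).div_const _
  have dxiSz : HasDerivAt (fun z' => xiS S B x y z' t) (1 / (S x y t - B x y t)) z :=
    ((hasDerivAt_id z).sub_const (B x y t)).div_const _
  have duxx : HasDerivAt (fun x' => ux S B uxS uxB lam x' y z t) _ x :=
    (((dx uxS huxS).sub (dx uxB huxB)).mul
      ((dxix.rpow_const (p := lam) (Or.inl hxi.ne')).const_sub 1)).add (dx uxB huxB)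
  have duxz : HasDerivAt (fun z' => ux S B uxS uxB lam x y z' t) _ z :=
    (((dxiz.rpow_const (p := lam) (Or.inl hxi.ne')).const_sub 1).const_mul
      (uxS x y t - uxB x y t)).add_const (uxB x y t)
  have duzS : HasDerivAt (fun z' => uzS S B uxS uxB fS lam uy x y z' t) _ z :=
    ((duxz.mul_const (pdx S x y t)).const_add
      (-(normGrad S x y t) * fS x y t + pdt S x y t)).add (duy.mul_const (pdy S x y t))
  have duzB : HasDerivAt (fun z' => uzB S B uxS uxB fB lam uy x y z' t) _ z :=
    ((duxz.mul_const (pdx B x y t)).const_add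
      (normGrad B x y t * fB x y t + pdt B x y t)).add (duy.mul_const (pdy B x y t))
  have duz : HasDerivAt (fun z' => uz S B uxS uxB fS fB lam uy x y z' t) _ z :=
    (dxiSz.mul duzS).add (dxiz.mul duzB)
  rw [duxx.deriv, duz.deriv]
  simp only [coefA, coefG, coefC, eHx, eHy, eHt, uzS, uzB, ux, Pi.sub_apply]
  generalize xiB S B x y z t ^ lam = P
  generalize xiB S B x y z t ^ (lam - 1) = Q
  simp only [xiB, xiS]
  field_simp
  ring


end
end
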